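/- For every real p ≥ 6 and every σ with 1 + 1/(5p) ≤ σ ≤ 1 + 1.37/√p, one has g(p,σ) < 0, where g(p,σ) = -(1 + σ^p)^{1 + 1/p}(B(p,σ)^{p-1} - τ(p,σ)^{p-1} A(p,σ)^{p-1}) ∂Δ(p,σ)/∂σ. -/

import Mathlib

/-- `σ_p = (2^p - 1)^{1/p}`. -/
noncomputable def sigmaP (p : ℝ) : ℝ := (2 ^ p - 1) ^ (1 / p)

/-- `A = A(p,σ,τ) = (1 + τ^p)^{-1/p} - (1 + σ^p)^{-1/p}`. -/
noncomputable def Acoef (p σ τ : ℝ) : ℝ := (1 + τ ^ p) ^ (-1 / p) - (1 + σ ^ p) ^ (-1 / p)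

/-- `B = B(p,σ,τ) = σ (1 + σ^p)^{-1/p} + τ (1 + τ^p)^{-1/p}`. -/
noncomputable def Bcoef (p σ τ : ℝ) : ℝ :=
  σ * (1 + σ ^ p) ^ (-1 / p) + τ * (1 + τ ^ p) ^ (-1 / p)

/-- Given the branch `T : σ ↦ τ(p,σ)`, the Minkowski–Cohn function
`Δ(p,σ) = (τ(p,σ) + σ)(1 + τ(p,σ)^p)^{-1/p}(1 + σ^p)^{-1/p}`. -/
noncomputable def DeltaFun (p : ℝ) (T : ℝ → ℝ) (σ : ℝ) : ℝ :=
  (T σ + σ) * (1 + T σ ^ p) ^ (-1 / p) * (1 + σ ^ p) ^ (-1 / p)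

/-- Given the branch `T : σ ↦ τ(p,σ)`, the function
`g(p,σ) = -(1 + σ^p)^{1 + 1/p} (B^{p-1} - τ^{p-1} A^{p-1}) ∂Δ(p,σ)/∂σ`. -/
noncomputable def gFun (p : ℝ) (T : ℝ → ℝ) (σ : ℝ) : ℝ :=
  -(1 + σ ^ p) ^ (1 + 1 / p) *
    (Bcoef p σ (T σ) ^ (p - 1) - T σ ^ (p - 1) * Acoef p σ (T σ) ^ (p - 1)) *
    derivWithin (DeltaFun p T) (Set.Icc 1 (sigmaP p)) σ

section

open Real Filter Topology Asymptotics

/-- Implicit differentiation along a continuous branch of a level set. -/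
lemma hasDerivAt_of_level_set {F : ℝ × ℝ → ℝ} {F' : ℝ × ℝ →L[ℝ] ℝ} {T : ℝ → ℝ} {x a b : ℝ}
    (hF : HasFDerivAt F F' (x, T x)) (hF' : ∀ z, F' z = a * z.1 + b * z.2) (hb : b ≠ 0)
    (hT : ContinuousAt T x) (hlevel : ∀ᶠ y in 𝓝 x, F (y, T y) = F (x, T x)) :
    HasDerivAt T (-a / b) x := by
  have htend : Tendsto (fun y => (y, T y)) (𝓝 x) (𝓝 (x, T x)) :=
    tendsto_id.prodMk_nhds hT
  have h1 : (fun y => a * (y - x) + b * (T y - T x)) =o[𝓝 x]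
      fun y => ((y, T y) : ℝ × ℝ) - (x, T x) := by
    have h := (hF.isLittleO.comp_tendsto htend).neg_left
    refine h.congr' ?_ (by rfl)
    filter_upwards [hlevel] with y hy
    simp [hy, hF']
  have h2 : (fun y => T y - T x - (-a / b) * (y - x)) =o[𝓝 x]
      fun y => ((y, T y) : ℝ × ℝ) - (x, T x) := by
    refine (h1.const_mul_left b⁻¹).congr_left fun y => ?_
    field_simp
    ring
  have h3 : (fun y => ((y, T y) : ℝ × ℝ) - (x, T x)) =O[𝓝 x] fun y => y - x := by
    have hbound := h2.bound (show (0 : ℝ) < 1 / 2 by norm_num)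
    refine IsBigO.of_bound (1 + 2 * |a / b|) ?_
    filter_upwards [hbound] with y hy
    simp only [Prod.mk_sub_mk, Prod.norm_mk, norm_eq_abs] at hy ⊢
    have hab : |(-a / b) * (y - x)| = |a / b| * |y - x| := by
      rw [abs_mul, neg_div, abs_neg]
    have htri : |T y - T x| ≤ |T y - T x - (-a / b) * (y - x)| + |(-a / b) * (y - x)| := by
      simpa using abs_add_le (T y - T x - (-a / b) * (y - x)) ((-a / b) * (y - x))
    rw [hab] at htri
    have hnn : 0 ≤ |a / b| * |y - x| := by positivity
    rcases max_cases |y - x| |T y - T x| with h | h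
    · rw [h.1]
      nlinarith [abs_nonneg (y - x)]
    · rw [h.1] at hy ⊢
      nlinarith [abs_nonneg (y - x)]
  rw [hasDerivAt_iff_isLittleO]
  refine (h2.trans_isBigO h3).congr_left fun y => ?_
  simp [mul_comm]

lemma one_add_rpow_pos {t : ℝ} (ht : 0 ≤ t) (p : ℝ) : 0 < 1 + t ^ p := by
  positivity

lemma hasDerivAt_one_add_rpow {p t : ℝ} (hp : 1 ≤ p) (ht : 0 ≤ t) :
    HasDerivAt (fun x : ℝ => (1 + x ^ p) ^ (-1 / p))
      (-t ^ (p - 1) * (1 + t ^ p) ^ (-1 / p - 1)) t := by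
  have h := ((Real.hasDerivAt_rpow_const (Or.inr hp) : HasDerivAt _ _ t).const_add 1).rpow_const
    (p := -1 / p) (Or.inl (one_add_rpow_pos ht p).ne')
  refine h.congr_deriv ?_
  have : p ≠ 0 := by linarith
  field_simp

lemma hasDerivAt_mul_one_add_rpow {p t : ℝ} (hp : 1 < p) (ht : 0 ≤ t) :
    HasDerivAt (fun x : ℝ => x * (1 + x ^ p) ^ (-1 / p)) ((1 + t ^ p) ^ (-1 / p - 1)) t := by
  refine ((hasDerivAt_id t).mul (hasDerivAt_one_add_rpow hp.le ht)).congr_deriv ?_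
  have h1 : (1 + t ^ p) ^ (-1 / p) = (1 + t ^ p) ^ (-1 / p - 1) * (1 + t ^ p) := by
    rw [← Real.rpow_add_one (one_add_rpow_pos ht p).ne']
    ring_nf
  have h2 : t * t ^ (p - 1) = t ^ p := by
    rw [← Real.rpow_one_add' ht (by linarith)]
    ring_nf
  simp only [id, h1]
  linear_combination (-(1 + t ^ p) ^ (-1 / p - 1)) * h2

lemma one_add_rpow_le_one {p t : ℝ} (hp : 0 < p) (ht : 0 ≤ t) : (1 + t ^ p) ^ (-1 / p) ≤ 1 :=
  Real.rpow_le_one_of_one_le_of_nonpos (by linarith [Real.rpow_nonneg ht p])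
    (div_nonpos_of_nonpos_of_nonneg (by norm_num) hp.le)

lemma Acoef_nonneg {p σ τ : ℝ} (hp : 0 < p) (hτ : 0 ≤ τ) (hτσ : τ ≤ σ) :
    0 ≤ Acoef p σ τ := by
  refine sub_nonneg.2 (Real.rpow_le_rpow_of_nonpos (one_add_rpow_pos hτ p) ?_
    (div_nonpos_of_nonpos_of_nonneg (by norm_num) hp.le))
  gcongr

lemma mul_le_Bcoef {p σ τ : ℝ} (hτ : 0 ≤ τ) :
    σ * (1 + σ ^ p) ^ (-1 / p) ≤ Bcoef p σ τ :=
  le_add_of_nonneg_right (mul_nonneg hτ (Real.rpow_nonneg (one_add_rpow_pos hτ p).le _))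

lemma Bcoef_pos {p σ τ : ℝ} (hσ : 0 < σ) (hτ : 0 ≤ τ) : 0 < Bcoef p σ τ :=
  (mul_pos hσ (Real.rpow_pos_of_pos (one_add_rpow_pos hσ.le p) _)).trans_le (mul_le_Bcoef hτ)

lemma Acoef_le_one_sub {p σ τ : ℝ} (hp : 0 < p) (hτ : 0 ≤ τ) :
    Acoef p σ τ ≤ 1 - (1 + σ ^ p) ^ (-1 / p) :=
  sub_le_sub_right (one_add_rpow_le_one hp hτ) _

lemma Acoef_le_Bcoef {p σ τ : ℝ} (hp : 1 ≤ p) (hσ : 0 ≤ σ) (hτ : 0 ≤ τ) :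
    Acoef p σ τ ≤ Bcoef p σ τ := by
  have hp0 : 0 < p := by linarith
  have h1 : (1 + σ ^ p) ^ (1 / p) ≤ 1 + σ := by
    have h := Real.add_rpow_le_rpow_add zero_le_one hσ hp
    rw [Real.one_rpow] at h
    calc (1 + σ ^ p) ^ (1 / p) ≤ ((1 + σ) ^ p) ^ (1 / p) := by gcongr
      _ = 1 + σ := by
        rw [← Real.rpow_mul (by linarith), mul_one_div_cancel hp0.ne', Real.rpow_one]
  have h2 : (1 + σ ^ p) ^ (-1 / p) * (1 + σ ^ p) ^ (1 / p) = 1 := by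
    rw [← Real.rpow_add (one_add_rpow_pos hσ p), ← add_div]
    simp
  have h3 : 1 ≤ (1 + σ ^ p) ^ (-1 / p) * (1 + σ) :=
    h2.symm.le.trans (by gcongr)
  linarith [Acoef_le_one_sub (σ := σ) hp0 hτ, mul_le_Bcoef (p := p) (σ := σ) hτ]

lemma rpow_mul_Acoef_lt_Bcoef {p σ τ : ℝ} (hp : 1 < p) (hσ : 1 ≤ σ) (hτ : 0 ≤ τ) (hτ1 : τ < 1) :
    0 < Bcoef p σ τ ^ (p - 1) - τ ^ (p - 1) * Acoef p σ τ ^ (p - 1) := by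
  have hA := Acoef_nonneg (p := p) (by linarith) hτ (hτ1.le.trans hσ)
  have hAB := Acoef_le_Bcoef (σ := σ) hp.le (by linarith) hτ
  have hB := Bcoef_pos (p := p) (σ := σ) (by linarith) hτ
  have h1 : τ ^ (p - 1) < 1 := Real.rpow_lt_one hτ hτ1 (by linarith)
  have h2 : Acoef p σ τ ^ (p - 1) ≤ Bcoef p σ τ ^ (p - 1) :=
    Real.rpow_le_rpow hA hAB (by linarith)
  have h3 : 0 < Bcoef p σ τ ^ (p - 1) := Real.rpow_pos_of_pos hB _
  nlinarith [Real.rpow_nonneg hτ (p - 1)]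

lemma hasFDerivAt_constraint {p σ τ : ℝ} (hp : 1 < p) (hσ : 0 ≤ σ) (hτ : 0 ≤ τ) :
    ∃ F' : ℝ × ℝ →L[ℝ] ℝ,
      HasFDerivAt (fun z : ℝ × ℝ => Acoef p z.1 z.2 ^ p + Bcoef p z.1 z.2 ^ p) F' (σ, τ) ∧
      ∀ z, F' z =
        p * (1 + σ ^ p) ^ (-1 / p - 1) *
          (Bcoef p σ τ ^ (p - 1) + σ ^ (p - 1) * Acoef p σ τ ^ (p - 1)) * z.1 +
        p * (1 + τ ^ p) ^ (-1 / p - 1) *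
          (Bcoef p σ τ ^ (p - 1) - τ ^ (p - 1) * Acoef p σ τ ^ (p - 1)) * z.2 := by
  have hfst : HasFDerivAt (Prod.fst : ℝ × ℝ → ℝ) (ContinuousLinearMap.fst ℝ ℝ ℝ) (σ, τ) := hasFDerivAt_fst
  have hsnd : HasFDerivAt (Prod.snd : ℝ × ℝ → ℝ) (ContinuousLinearMap.snd ℝ ℝ ℝ) (σ, τ) := hasFDerivAt_snd
  have hA := (((hasDerivAt_one_add_rpow hp.le hτ).comp_hasFDerivAt (σ, τ) hsnd).sub
    ((hasDerivAt_one_add_rpow hp.le hσ).comp_hasFDerivAt (σ, τ) hfst)).rpow_const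
    (Or.inr hp.le)
  have hB := (((hasDerivAt_mul_one_add_rpow hp hσ).comp_hasFDerivAt (σ, τ) hfst).add
    ((hasDerivAt_mul_one_add_rpow hp hτ).comp_hasFDerivAt (σ, τ) hsnd)).rpow_const
    (Or.inr hp.le)
  refine ⟨_, hA.add hB, fun z => ?_⟩
  simp [Acoef, Bcoef]
  ring

lemma hasDerivAt_constraint_snd {p σ τ : ℝ} (hp : 1 < p) (hσ : 0 ≤ σ) (hτ : 0 ≤ τ) :
    HasDerivAt (fun t : ℝ => Acoef p σ t ^ p + Bcoef p σ t ^ p)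
      (p * (1 + τ ^ p) ^ (-1 / p - 1) *
          (Bcoef p σ τ ^ (p - 1) - τ ^ (p - 1) * Acoef p σ τ ^ (p - 1))) τ := by
  obtain ⟨F', hF, hF'⟩ := hasFDerivAt_constraint hp hσ hτ
  have h := hF.comp_hasDerivAt τ ((hasDerivAt_const τ σ).prodMk (hasDerivAt_id τ))
  refine h.congr_deriv ?_
  simp [hF']

lemma strictMonoOn_constraint {p σ : ℝ} (hp : 1 < p) (hσ : 1 ≤ σ) :
    StrictMonoOn (fun t : ℝ => Acoef p σ t ^ p + Bcoef p σ t ^ p) (Set.Ico 0 1) := by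
  refine strictMonoOn_of_deriv_pos (convex_Ico 0 1) (fun t ht =>
    (hasDerivAt_constraint_snd hp (by linarith) ht.1).continuousAt.continuousWithinAt)
    fun t ht => ?_
  rw [interior_Ico] at ht
  rw [(hasDerivAt_constraint_snd hp (by linarith) ht.1.le).deriv]
  have h1 := rpow_mul_Acoef_lt_Bcoef hp hσ ht.1.le ht.2
  have h2 := Real.rpow_pos_of_pos (one_add_rpow_pos ht.1.le p) (-1 / p - 1)
  positivity

lemma continuousAt_constraint_fst {p σ τ : ℝ} (hp : 1 < p) (hσ : 0 ≤ σ) (hτ : 0 ≤ τ) :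
    ContinuousAt (fun s : ℝ => Acoef p s τ ^ p + Bcoef p s τ ^ p) σ := by
  obtain ⟨F', hF, -⟩ := hasFDerivAt_constraint hp hσ hτ
  exact ContinuousAt.comp (f := fun s : ℝ => (s, τ)) hF.continuousAt (by fun_prop)

/-- A branch of solutions of the constraint inside `[0, c]`, `c < 1`, is continuous. -/
lemma continuousAt_branch {p σ c : ℝ} {T : ℝ → ℝ} (hp : 1 < p) (hσ : 1 < σ) (hc : c < 1)
    (hT : ∀ᶠ s in 𝓝 σ,
      0 ≤ T s ∧ T s ≤ c ∧ Acoef p s (T s) ^ p + Bcoef p s (T s) ^ p = 1) :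
    ContinuousAt T σ := by
  have hσT := hT.self_of_nhds
  have hgt : ∀ᶠ s in 𝓝 σ, 1 ≤ s := (eventually_gt_nhds hσ).mono fun s hs => hs.le
  refine tendsto_order.2 ⟨fun a ha => ?_, fun a ha => ?_⟩
  · rcases lt_or_ge a 0 with ha0 | ha0
    · filter_upwards [hT] with s hs using ha0.trans_le hs.1
    have h := strictMonoOn_constraint hp hσ.le ⟨ha0, by linarith⟩ ⟨hσT.1, by linarith⟩ ha
    simp only [hσT.2.2] at h
    have hev := (continuousAt_constraint_fst hp (by linarith) ha0).eventually_lt_const h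
    filter_upwards [hT, hgt, hev] with s hs hs1 hlt
    by_contra! hle
    have := (strictMonoOn_constraint hp hs1).monotoneOn ⟨hs.1, by linarith⟩
      ⟨ha0, by linarith⟩ hle
    simp only [hs.2.2] at this
    linarith
  · rcases lt_or_ge c a with hca | hca
    · filter_upwards [hT] with s hs using hs.2.1.trans_lt hca
    have ha0 : 0 ≤ a := hσT.1.trans ha.le
    have h := strictMonoOn_constraint hp hσ.le ⟨hσT.1, by linarith⟩ ⟨ha0, by linarith⟩ ha
    simp only [hσT.2.2] at h
    have hev := (continuousAt_constraint_fst hp (by linarith) ha0).eventually_const_lt h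
    filter_upwards [hT, hgt, hev] with s hs hs1 hlt
    by_contra! hle
    have := (strictMonoOn_constraint hp hs1).monotoneOn ⟨ha0, by linarith⟩
      ⟨hs.1, by linarith⟩ hle
    simp only [hs.2.2] at this
    linarith

/-- The derivative of `DeltaFun` along a branch, cleared of denominators, gives a closed
form for `gFun`. -/
lemma gFun_eq {p σ c : ℝ} {T : ℝ → ℝ} (hp : 1 < p) (hσ : σ ∈ Set.Ioo 1 (sigmaP p)) (hc : c < 1)
    (hT : ∀ s ∈ Set.Icc 1 (sigmaP p),
      0 ≤ T s ∧ T s ≤ c ∧ Acoef p s (T s) ^ p + Bcoef p s (T s) ^ p = 1) :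
    gFun p T σ =
      (1 + σ ^ p) ^ (-1 / p) * (1 - σ * T σ ^ (p - 1)) *
        (Bcoef p σ (T σ) ^ (p - 1) + σ ^ (p - 1) * Acoef p σ (T σ) ^ (p - 1)) -
      (1 + T σ ^ p) ^ (-1 / p) * (1 - T σ * σ ^ (p - 1)) *
        (Bcoef p σ (T σ) ^ (p - 1) - T σ ^ (p - 1) * Acoef p σ (T σ) ^ (p - 1)) := by
  have hσ0 : 0 ≤ σ := by linarith [hσ.1]
  have hTev : ∀ᶠ s in 𝓝 σ, 0 ≤ T s ∧ T s ≤ c ∧ Acoef p s (T s) ^ p + Bcoef p s (T s) ^ p = 1 := by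
    filter_upwards [Icc_mem_nhds hσ.1 hσ.2] with s hs using hT s hs
  obtain ⟨hτ0, hτc, hτ⟩ := hT σ (Set.Ioo_subset_Icc_self hσ)
  have hpos := rpow_mul_Acoef_lt_Bcoef hp hσ.1.le hτ0 (hτc.trans_lt hc)
  have hkτ := Real.rpow_pos_of_pos (one_add_rpow_pos hτ0 p) (-1 / p - 1)
  have hkσ := Real.rpow_pos_of_pos (one_add_rpow_pos hσ0 p) (-1 / p - 1)
  obtain ⟨F', hF, hF'⟩ := hasFDerivAt_constraint hp hσ0 hτ0
  have hderivT := hasDerivAt_of_level_set hF hF' (by positivity)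
    (continuousAt_branch hp hσ.1 hc hTev)
    (by filter_upwards [hTev] with s hs using by simp only [hs.2.2, hτ])
  have hU := (hasDerivAt_one_add_rpow hp.le hτ0).comp σ hderivT
  have hV := (hasDerivAt_mul_one_add_rpow hp hτ0).comp σ hderivT
  have hS := hasDerivAt_one_add_rpow hp.le hσ0
  have hX := hasDerivAt_mul_one_add_rpow hp hσ0
  have hΔ : HasDerivAt (DeltaFun p T) _ σ :=
    ((hV.mul hS).add (hU.mul hX)).congr_of_eventuallyEq
      (Filter.Eventually.of_forall fun s => by
        simp only [DeltaFun, Pi.add_apply, Pi.mul_apply, Function.comp_apply]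
        ring)
  have hk : (1 + σ ^ p) ^ (1 + 1 / p) * (1 + σ ^ p) ^ (-1 / p - 1) = 1 := by
    rw [← Real.rpow_add (one_add_rpow_pos hσ0 p)]
    ring_nf
    simp
  rw [gFun, hΔ.hasDerivWithinAt.derivWithin
    (uniqueDiffOn_Icc (hσ.1.trans hσ.2) σ (Set.Ioo_subset_Icc_self hσ))]
  simp only [Function.comp_apply]
  generalize Bcoef p σ (T σ) ^ (p - 1) = b at *
  generalize Acoef p σ (T σ) ^ (p - 1) = a at *
  generalize (1 + σ ^ p) ^ (1 + 1 / p) = K at *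
  generalize (1 + σ ^ p) ^ (-1 / p - 1) = kσ at *
  generalize (1 + T σ ^ p) ^ (-1 / p - 1) = kτ at *
  generalize (1 + σ ^ p) ^ (-1 / p) = s at *
  generalize (1 + T σ ^ p) ^ (-1 / p) = u at *
  generalize T σ ^ (p - 1) = q at *
  have hp0 : p ≠ 0 := by linarith
  have hd := hpos.ne'
  have hK : K = kσ⁻¹ := eq_inv_of_mul_eq_one_left hk
  rw [hK]
  field_simp
  ring

lemma sub_one_mul_log_one_add_inv_le {w : ℝ} (hw : 1 ≤ w) :
    (w - 1) * log (1 + 1 / w) ≤ 3 / 4 * log w := by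
  have hw0 : 0 < w := by linarith
  have hlog : 2 * (w - 1) / (w + 1) ≤ log w := by
    have h := Real.le_log_one_add_of_nonneg (x := w - 1) (by linarith)
    have e1 : w - 1 + 2 = w + 1 := by ring
    have e2 : 1 + (w - 1) = w := by ring
    rwa [e1, e2] at h
  have hM : log (1 + 1 / w) ≤ 3 / 2 / (w + 1) := by
    rcases le_total 2 w with h2 | h2
    · have h := Real.log_le_sub_one_of_pos (x := 1 + 1 / w) (by positivity)
      refine h.trans ?_
      rw [add_sub_cancel_left, div_le_div_iff₀ hw0 (by linarith)]
      linarith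
    · have e : 1 + 1 / w = 2 * ((w + 1) / (2 * w)) := by field_simp
      rw [e, Real.log_mul (by norm_num) (by positivity)]
      have h := Real.log_le_sub_one_of_pos (x := (w + 1) / (2 * w)) (by positivity)
      have hl := Real.log_two_lt_d9
      have key : 0.6931471808 + ((w + 1) / (2 * w) - 1) ≤ 3 / 2 / (w + 1) := by
        rw [← sub_nonneg]
        have e : 3 / 2 / (w + 1) - (0.6931471808 + ((w + 1) / (2 * w) - 1))
            = (3 * w - 2 * 0.6931471808 * w * (w + 1) - (1 - w) * (w + 1)) /
              (2 * w * (w + 1)) := by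
          field_simp
          ring
        rw [e]
        apply div_nonneg _ (by positivity)
        nlinarith
      linarith
  calc (w - 1) * log (1 + 1 / w) ≤ (w - 1) * (3 / 2 / (w + 1)) :=
        mul_le_mul_of_nonneg_left hM (by linarith)
    _ = 3 / 4 * (2 * (w - 1) / (w + 1)) := by ring
    _ ≤ 3 / 4 * log w := by linarith

lemma pow_five_add_lt {δ e y : ℝ} (he : 0 < e) (he6 : e ≤ 1 / 6) (heδ : e ≤ 5 * δ)
    (hδ : δ ≤ 0.56) (hy0 : 0 ≤ y) (hy : y ≤ δ + (1 + δ) * (e ^ 2 / (e + δ))) :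
    y < 1 ∧ y ^ 5 + 0.0014 * δ < δ / (2 * (2 + δ)) := by
  have hδ0 : 0 < δ := by linarith
  have h5 : e ^ 2 / (e + δ) ≤ 25 / 6 * δ := by
    rw [div_le_iff₀ (by linarith)]
    nlinarith
  have h6 : e ^ 2 / (e + δ) ≤ 1 / (6 + 36 * δ) := by
    rw [div_le_div_iff₀ (by linarith) (by linarith)]
    nlinarith [mul_nonneg he.le (sub_nonneg.2 he6), mul_nonneg hδ0.le (sub_nonneg.2 he6),
      mul_nonneg (mul_nonneg hδ0.le he.le) (sub_nonneg.2 he6)]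
  have hyδ : y ≤ δ + (1 + δ) * (25 / 6 * δ) :=
    hy.trans (by gcongr)
  have hy6 : y ≤ δ + (1 + δ) / (6 + 36 * δ) := by
    refine hy.trans ?_
    rw [div_eq_mul_one_div (1 + δ)]
    gcongr
  have segment : ∀ a b c : ℝ, 0 ≤ a → a ≤ δ → δ ≤ b → b + (1 + a) / (6 + 36 * a) ≤ c → c < 1 →
      c ^ 5 + 0.0014 * b < a / (2 * (2 + a)) →
      y < 1 ∧ y ^ 5 + 0.0014 * δ < δ / (2 * (2 + δ)) := by
    intro a b c ha haδ hδb hc hc1 h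
    have h1 : (1 + δ) / (6 + 36 * δ) ≤ (1 + a) / (6 + 36 * a) := by
      rw [div_le_div_iff₀ (by linarith) (by linarith)]
      nlinarith
    have h2 : a / (2 * (2 + a)) ≤ δ / (2 * (2 + δ)) := by
      rw [div_le_div_iff₀ (by linarith) (by linarith)]
      nlinarith
    have hyc : y ≤ c := by linarith
    have := pow_le_pow_left₀ hy0 hyc 5
    exact ⟨by linarith, by linarith⟩
  rcases le_total δ 0.2 with h | h
  · have h1 : (1 + δ) / (6 + 36 * δ) ≤ 1 / 6 := by
      rw [div_le_div_iff₀ (by linarith) (by norm_num)]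
      linarith
    have hy' : y ≤ 0.37 := by linarith
    have hy6 : y ≤ 6 * δ := by nlinarith
    have h4 : y ^ 4 ≤ 0.37 ^ 4 := pow_le_pow_left₀ hy0 hy' 4
    refine ⟨by linarith, ?_⟩
    have h5 : y ^ 5 ≤ 6 * δ * 0.37 ^ 4 := by
      calc y ^ 5 = y * y ^ 4 := by ring
        _ ≤ _ := by gcongr
    have : 0.2 * δ ≤ δ / (2 * (2 + δ)) := by
      rw [le_div_iff₀ (by linarith)]
      nlinarith
    linarith
  rcases le_total δ 0.4 with h' | h'
  · exact segment 0.2 0.4 0.492 (by norm_num) h h' (by norm_num) (by norm_num) (by norm_num)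
  rcases le_total δ 0.5 with h'' | h''
  · exact segment 0.4 0.5 0.57 (by norm_num) h' h'' (by norm_num) (by norm_num) (by norm_num)
  · exact segment 0.5 0.56 0.6225 (by norm_num) h'' hδ (by norm_num) (by norm_num) (by norm_num)

lemma inv_one_add_rpow_eq {p σ : ℝ} (hp : 0 < p) (hσ : 0 < σ) :
    ((1 + σ ^ p) ^ (-1 / p))⁻¹ = σ * (1 + 1 / σ ^ p) ^ (1 / p) := by
  have hw : 0 < σ ^ p := Real.rpow_pos_of_pos hσ p
  have e : 1 + σ ^ p = σ ^ p * (1 + 1 / σ ^ p) := by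
    field_simp
    ring
  rw [← Real.rpow_neg (by positivity), neg_div, neg_neg, e, Real.mul_rpow hw.le (by positivity),
    ← Real.rpow_mul hσ.le, mul_one_div_cancel hp.ne', Real.rpow_one]

/-- The value of `g` when `τ^p` and `A^p` are neglected. -/
lemma rpow_sub_one_sub_le {p σ : ℝ} (hp : 0 < p) (hσ : 1 ≤ σ) :
    σ ^ (p - 1) - 1 - (σ ^ p - 1) * (1 + σ ^ p) ^ (-1 / p) ≤ -(log σ / (4 * σ)) := by
  have hσ0 : 0 < σ := by linarith
  have hw1 : 1 ≤ σ ^ p := Real.one_le_rpow hσ hp.le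
  have hinv := inv_one_add_rpow_eq hp hσ0
  have hM := sub_one_mul_log_one_add_inv_le hw1
  rw [Real.log_rpow hσ0] at hM
  have hm : 0 < 1 + 1 / σ ^ p := by positivity
  have hs : 1 - log (1 + 1 / σ ^ p) / p ≤ σ * (1 + σ ^ p) ^ (-1 / p) := by
    have e : σ * (1 + σ ^ p) ^ (-1 / p) = Real.exp (-(log (1 + 1 / σ ^ p) / p)) := by
      rw [← inv_inv ((1 + σ ^ p) ^ (-1 / p)), hinv, mul_inv, mul_inv_cancel_left₀ hσ0.ne',
        Real.rpow_def_of_pos hm, ← Real.exp_neg, mul_one_div]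
    rw [e]
    linarith [Real.add_one_le_exp (-(log (1 + 1 / σ ^ p) / p))]
  have hlog := Real.log_le_sub_one_of_pos hσ0
  have hMp : (σ ^ p - 1) * (log (1 + 1 / σ ^ p) / p) ≤ 3 / 4 * log σ := by
    rw [← mul_div_assoc, div_le_iff₀ hp]
    linarith
  have hmul := mul_le_mul_of_nonneg_left hs (sub_nonneg.2 hw1)
  have hpow : σ * σ ^ (p - 1) = σ ^ p := by
    rw [← Real.rpow_one_add' hσ0.le (by linarith)]
    ring_nf
  have h4 : log σ / (4 * σ) = log σ / 4 / σ := by field_simp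
  rw [h4, ← neg_div, le_div_iff₀ hσ0]
  nlinarith

/-- The size of `(1 + σ^p)^{1/p} - 1`. -/
lemma inv_one_add_rpow_sub_one_le {p σ : ℝ} (hp : 1 ≤ p) (hσ : 1 ≤ σ) :
    ((1 + σ ^ p) ^ (-1 / p))⁻¹ - 1 ≤
      (σ - 1) + (1 + (σ - 1)) * ((1 / p) ^ 2 / (1 / p + (σ - 1))) := by
  have hp0 : 0 < p := by linarith
  have hw := one_add_mul_self_le_rpow_one_add (s := σ - 1) (by linarith) hp
  rw [add_sub_cancel] at hw
  have hb : 0 < 1 + p * (σ - 1) := by nlinarith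
  have hm : (1 + 1 / σ ^ p) ^ (1 / p) ≤ 1 + 1 / p * (1 / σ ^ p) :=
    rpow_one_add_le_one_add_mul_self (by linarith [one_div_pos.2 (hb.trans_le hw)])
      (by positivity) (by rw [div_le_one hp0]; exact hp)
  have hm' : 1 / p * (1 / σ ^ p) ≤ 1 / p * (1 / (1 + p * (σ - 1))) := by gcongr
  have e : 1 / p * (1 / (1 + p * (σ - 1))) = (1 / p) ^ 2 / (1 / p + (σ - 1)) := by
    have : 1 / p + (σ - 1) = (1 + p * (σ - 1)) / p := by field_simp
    rw [this]
    field_simp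
  rw [inv_one_add_rpow_eq hp0 (by linarith), ← e]
  nlinarith

lemma one_sub_div_le_one_add_rpow {p x : ℝ} (hp : 0 < p) (hx : 0 ≤ x) :
    1 - x / p ≤ (1 + x) ^ (-1 / p) := by
  rw [Real.rpow_def_of_pos (by linarith)]
  have h1 := Real.add_one_le_exp (log (1 + x) * (-1 / p))
  have h2 := Real.log_le_sub_one_of_pos (x := 1 + x) (by linarith)
  have h3 : log (1 + x) / p ≤ x / p := by
    gcongr
    linarith
  have h4 : log (1 + x) * (-1 / p) = -(log (1 + x) / p) := by ring
  linarith

lemma rpow_le_pow_five {p y : ℝ} (hp : 6 ≤ p) (hy0 : 0 ≤ y) (hy1 : y ≤ 1) :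
    y ^ (p - 1) ≤ y ^ 5 := by
  rw [← Real.rpow_natCast]
  exact Real.rpow_le_rpow_of_exponent_ge_of_imp hy0 hy1 (by norm_num; linarith)
    (fun _ h => absurd h (by linarith))

lemma closed_form_neg {p σ τ : ℝ} (hp : 6 ≤ p) (hσ : 1 + 1 / (5 * p) ≤ σ) (hσ' : σ ≤ 1.56)
    (hτ : 0 ≤ τ) (hτ' : p * τ ≤ 0.7) (h : Acoef p σ τ ^ p + Bcoef p σ τ ^ p = 1) :
    (1 + σ ^ p) ^ (-1 / p) * (1 - σ * τ ^ (p - 1)) *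
        (Bcoef p σ τ ^ (p - 1) + σ ^ (p - 1) * Acoef p σ τ ^ (p - 1)) -
      (1 + τ ^ p) ^ (-1 / p) * (1 - τ * σ ^ (p - 1)) *
        (Bcoef p σ τ ^ (p - 1) - τ ^ (p - 1) * Acoef p σ τ ^ (p - 1)) < 0 := by
  have hp0 : 0 < p := by linarith
  have hδ5 : 1 / p ≤ 5 * (σ - 1) := by
    have : 1 / (5 * p) = 1 / p / 5 := by field_simp
    linarith
  have hpinv : 0 < 1 / p := by positivity
  have hpinv6 : 1 / p ≤ 1 / 6 := by gcongr
  have hσ1 : 1 ≤ σ := by linarith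
  have hσ0 : 0 < σ := by linarith
  have hτp : τ ≤ 0.7 * (1 / p) := by
    rw [mul_one_div, le_div_iff₀ hp0]
    linarith
  have hτ1 : τ ≤ 0.12 := by linarith
  have hA := Acoef_nonneg hp0 hτ (show τ ≤ σ by linarith)
  have hA' := Acoef_le_one_sub (σ := σ) hp0 hτ
  have hAB := Acoef_le_Bcoef (p := p) (by linarith) hσ0.le hτ
  have hB := Bcoef_pos (p := p) hσ0 hτ
  have hσsB := mul_le_Bcoef (p := p) (σ := σ) hτ
  have hB1 : Bcoef p σ τ ≤ 1 := by
    by_contra! hlt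
    have h1 := Real.one_lt_rpow hlt hp0
    linarith [Real.rpow_nonneg hA p]
  have hBdef : Bcoef p σ τ = σ * (1 + σ ^ p) ^ (-1 / p) + τ * (1 + τ ^ p) ^ (-1 / p) := rfl
  have hmain := rpow_sub_one_sub_le hp0 hσ1
  have hy := inv_one_add_rpow_sub_one_le (p := p) (by linarith) hσ1
  have hs0 : 0 < (1 + σ ^ p) ^ (-1 / p) :=
    Real.rpow_pos_of_pos (one_add_rpow_pos hσ0.le p) _
  have hs1 := one_add_rpow_le_one hp0 hσ0.le
  have hu0 : 0 < (1 + τ ^ p) ^ (-1 / p) := Real.rpow_pos_of_pos (one_add_rpow_pos hτ p) _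
  have hu1 := one_add_rpow_le_one hp0 hτ
  have hu := one_sub_div_le_one_add_rpow hp0 (Real.rpow_nonneg hτ p)
  have hpow : σ * σ ^ (p - 1) = σ ^ p := by
    rw [← Real.rpow_one_add' hσ0.le (by linarith)]
    ring_nf
  have hlog : 2 * (σ - 1) / (2 + (σ - 1)) ≤ log σ := by
    have h := Real.le_log_one_add_of_nonneg (x := σ - 1) (by linarith)
    rwa [add_sub_cancel, add_comm (σ - 1) 2] at h
  set s := (1 + σ ^ p) ^ (-1 / p)
  set u := (1 + τ ^ p) ^ (-1 / p)
  set A := Acoef p σ τ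
  set B := Bcoef p σ τ
  set y := s⁻¹ - 1 with hydef
  have hy0 : 0 ≤ y := sub_nonneg.2 ((one_le_inv₀ hs0).2 hs1)
  obtain ⟨hy1, hy5⟩ := pow_five_add_lt hpinv hpinv6 hδ5 (by linarith) hy0 hy
  have hσA : σ * A ≤ y * B := by
    have e : y * s = 1 - s := by
      rw [hydef, sub_mul, inv_mul_cancel₀ hs0.ne', one_mul]
    have h1 : σ * A ≤ y * (σ * s) := by
      have := mul_le_mul_of_nonneg_left hA' hσ0.le
      rw [← e] at this
      linarith
    exact h1.trans (mul_le_mul_of_nonneg_left hσsB hy0)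
  have hσs : σ * s ≤ 1 := hσsB.trans hB1
  have hb0 : 0 < B ^ (p - 1) := Real.rpow_pos_of_pos hB _
  have ha0 : 0 ≤ A ^ (p - 1) := Real.rpow_nonneg hA _
  have hσp0 : 0 ≤ σ ^ (p - 1) := Real.rpow_nonneg hσ0.le _
  have hq0 : 0 ≤ τ ^ (p - 1) := Real.rpow_nonneg hτ _
  have hab : A ^ (p - 1) ≤ B ^ (p - 1) := Real.rpow_le_rpow hA hAB (by linarith)
  have hσab : σ ^ (p - 1) * A ^ (p - 1) ≤ y ^ 5 * B ^ (p - 1) := by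
    rw [← Real.mul_rpow hσ0.le hA]
    calc (σ * A) ^ (p - 1) ≤ (y * B) ^ (p - 1) :=
          Real.rpow_le_rpow (by positivity) hσA (by linarith)
      _ = y ^ (p - 1) * B ^ (p - 1) := Real.mul_rpow hy0 hB.le
      _ ≤ y ^ 5 * B ^ (p - 1) := by
          gcongr
          exact rpow_le_pow_five hp hy0 hy1.le
  have hq : τ ^ (p - 1) ≤ 0.00074 * (σ - 1) := by
    have h4 : τ ^ 4 ≤ 0.12 ^ 4 := pow_le_pow_left₀ hτ hτ1 4
    have h35 : τ ≤ 3.5 * (σ - 1) := by linarith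
    calc τ ^ (p - 1) ≤ τ ^ 5 := rpow_le_pow_five hp hτ (by linarith)
      _ = τ * τ ^ 4 := by ring
      _ ≤ 3.5 * (σ - 1) * 0.12 ^ 4 := by gcongr
      _ ≤ 0.00074 * (σ - 1) := by linarith
  have hτpow : τ ^ p / p ≤ 0.1 * τ ^ (p - 1) := by
    have e : τ ^ p = τ * τ ^ (p - 1) := by
      rw [← Real.rpow_one_add' hτ (by linarith)]
      ring_nf
    have h1 : τ * (1 / p) ≤ 0.12 * (1 / 6) := by gcongr
    calc τ ^ p / p = τ * (1 / p) * τ ^ (p - 1) := by rw [e]; ring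
      _ ≤ 0.1 * τ ^ (p - 1) := by
        gcongr
        linarith
  have hbracket : s + σ ^ (p - 1) * (1 - σ * s) - u + s * y ^ 5 + τ ^ (p - 1) < 0 := by
    have hsσ : s ≤ 1 / σ := by
      rw [le_div_iff₀ hσ0]
      linarith
    have h1 : s * y ^ 5 ≤ 1 / σ * y ^ 5 := by gcongr
    have h2 : y ^ 5 / σ + 0.0014 * (σ - 1) / σ < log σ / (4 * σ) := by
      rw [← add_div, div_lt_div_iff₀ hσ0 (by positivity)]
      have e : (σ - 1) / (2 * (2 + (σ - 1))) = (2 * (σ - 1) / (2 + (σ - 1))) / 4 := by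
        field_simp
        ring
      have h3 : y ^ 5 + 0.0014 * (σ - 1) < log σ / 4 := by linarith
      have h4 := mul_lt_mul_of_pos_right h3 (show 0 < 4 * σ by positivity)
      linarith
    have h3 : 1.1 * τ ^ (p - 1) ≤ 0.0014 * (σ - 1) / σ := by
      rw [le_div_iff₀ hσ0]
      have h4 := mul_le_mul hq hσ' hσ0.le (by linarith)
      linarith
    have h4 : σ ^ (p - 1) * (1 - σ * s) = σ ^ (p - 1) - σ ^ p * s := by
      rw [← hpow]
      ring
    have h5 : 1 / σ * y ^ 5 = y ^ 5 / σ := by ring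
    linarith
  have hterm : u * (1 - τ * σ ^ (p - 1)) ≤ 1 := by
    linarith [mul_nonneg (mul_nonneg hu0.le hτ) hσp0]
  have hτu : τ * u * σ ^ (p - 1) ≤ (1 - σ * s) * σ ^ (p - 1) := by
    gcongr
    linarith
  generalize B ^ (p - 1) = b at *
  generalize A ^ (p - 1) = a at *
  generalize τ ^ (p - 1) = q at *
  generalize σ ^ (p - 1) = v at *
  have hleft : s * (1 - σ * q) * (b + v * a) ≤ s * b + s * (y ^ 5 * b) := by
    have h1 : s * (1 - σ * q) ≤ s := by linarith [mul_nonneg (mul_nonneg hs0.le hσ0.le) hq0]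
    calc s * (1 - σ * q) * (b + v * a) ≤ s * (b + v * a) := by gcongr
      _ ≤ s * (b + y ^ 5 * b) := by gcongr
      _ = _ := by ring
  have hright : (u - (1 - σ * s) * v) * b - q * b ≤ u * (1 - τ * v) * (b - q * a) := by
    have h1 : u * (1 - τ * v) * (q * a) ≤ q * b :=
      calc u * (1 - τ * v) * (q * a) ≤ 1 * (q * a) := by gcongr
        _ ≤ q * b := by rw [one_mul]; gcongr
    have h2 : (u - (1 - σ * s) * v) * b ≤ u * (1 - τ * v) * b := by
      gcongr
      linarith
    linarith
  linarith [mul_neg_of_neg_of_pos hbracket hb0]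

lemma mul_le_of_two_mul_one_sub_rpow_eq {p t : ℝ} (hp : 0 ≤ p) (ht0 : 0 ≤ t) (ht1 : t < 1)
    (ht : 2 * (1 - t) ^ p = 1 + t ^ p) : p * t ≤ 0.7 := by
  have h1 : 0 ≤ log (2 * (1 - t) ^ p) :=
    Real.log_nonneg (by linarith [Real.rpow_nonneg ht0 p])
  have hpos : 0 < 1 - t := by linarith
  rw [Real.log_mul two_ne_zero (Real.rpow_pos_of_pos hpos p).ne', Real.log_rpow hpos] at h1
  have h2 := mul_le_mul_of_nonneg_left (Real.log_le_sub_one_of_pos hpos) hp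
  linarith [Real.log_two_lt_d9]

lemma lt_sigmaP {p : ℝ} (hp : 6 ≤ p) : 1.56 < sigmaP p := by
  have hp0 : 0 < p := by linarith
  have h2 : (2 : ℝ) ^ p = 1.6 ^ p * 1.25 ^ p := by
    rw [← Real.mul_rpow (by norm_num) (by norm_num)]
    norm_num
  have h3 := one_add_mul_self_le_rpow_one_add (s := 0.25) (by norm_num) (p := p) (by linarith)
  have h4 := one_add_mul_self_le_rpow_one_add (s := 0.6) (by norm_num) (p := p) (by linarith)
  norm_num at h3 h4
  have h5 : (1.6 : ℝ) ^ p ≤ 2 ^ p - 1 := by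
    rw [h2]
    norm_num
    nlinarith
  calc (1.56 : ℝ) < 1.6 := by norm_num
    _ = ((1.6 : ℝ) ^ p) ^ (1 / p) := by
      rw [← Real.rpow_mul (by norm_num), mul_one_div_cancel hp0.ne', Real.rpow_one]
    _ ≤ sigmaP p := Real.rpow_le_rpow (by positivity) h5 (by positivity)

end

/-- For every real `p ≥ 6` and every `σ` with
`1 + 1/(5p) ≤ σ ≤ 1 + 1.37/√p`, one has `g(p,σ) < 0`. -/
theorem stmt_11 (p : ℝ) (hp : 6 ≤ p) (τp : ℝ)
    (hτp : 0 ≤ τp ∧ τp < 1 ∧ 2 * (1 - τp) ^ p = 1 + τp ^ p)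
    (T : ℝ → ℝ)
    (hT : ∀ σ ∈ Set.Icc 1 (sigmaP p),
      0 ≤ T σ ∧ T σ ≤ τp ∧ Acoef p σ (T σ) ^ p + Bcoef p σ (T σ) ^ p = 1)
    (σ : ℝ) (hσ : σ ∈ Set.Icc (1 + 1 / (5 * p)) (1 + 1.37 / Real.sqrt p)) :
    gFun p T σ < 0 := by
  have hp0 : 0 < p := by linarith
  have hσ' : σ ≤ 1.56 := by
    have h1 : (2.4465 : ℝ) ≤ Real.sqrt p := Real.le_sqrt_of_sq_le (by norm_num; linarith)
    have h2 : 1.37 / Real.sqrt p ≤ 0.56 := by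
      rw [div_le_iff₀ (by linarith)]
      linarith
    linarith [hσ.2]
  have hσ1 : 1 < σ := by
    have : 0 < 1 / (5 * p) := by positivity
    linarith [hσ.1]
  have hmem : σ ∈ Set.Ioo 1 (sigmaP p) := ⟨hσ1, hσ'.trans_lt (lt_sigmaP hp)⟩
  obtain ⟨h0, h1, h2⟩ := hT σ (Set.Ioo_subset_Icc_self hmem)
  have hτ := mul_le_of_two_mul_one_sub_rpow_eq hp0.le hτp.1 hτp.2.1 hτp.2.2
  rw [gFun_eq (by linarith) hmem hτp.2.1 hT]
  exact closed_form_neg hp hσ.1 hσ' h0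
    ((mul_le_mul_of_nonneg_left h1 hp0.le).trans hτ) h2
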